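/- arXiv:1310.7531 — 5 statements merged into one kernel-verified Lean document; each statement's English description precedes it below -/
import Mathlib

section
/- Let T, T₀ ∈ ℚ⟦z⟧ be the formal power series T = ∑_{k≥1} k^{k-1} z^k/k! and T₀ = ∑_{k≥1} k^k z^k/k!, and let (F_n)_{n≥1} be the sequence of polynomials in ℚ[x] defined by F₁(x) = 1 and F_{n+1}(x) = (2n+2+(n+2)x)·F_n(x) + (1+x)²·F_n′(x). Then for every n ≥ 1, the n-th formal derivative of T₀ equals exp(n·T) · (1−T)^{−(n+2)} · F_n(T/(1−T)), where exp(n·T) = ∑_{k≥0} (nT)^k/k! (well defined since T has zero constant term), (1−T) is invertible since it has constant term 1, and F_n(T/(1−T)) denotes the evaluation of the polynomial F_n at the power series T/(1−T). -/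
open PowerSeries Polynomial

/-- The tree function `T = ∑_{k≥1} k^{k-1} z^k / k!` as a formal power series over `ℚ`. -/
noncomputable def treeT : PowerSeries ℚ :=
  PowerSeries.mk fun k => if k = 0 then 0 else (k : ℚ) ^ (k - 1) / (Nat.factorial k)

/-- The series `T₀ = ∑_{k≥1} k^k z^k / k!`. -/
noncomputable def treeT0 : PowerSeries ℚ :=
  PowerSeries.mk fun k => if k = 0 then 0 else (k : ℚ) ^ k / (Nat.factorial k)

/-- The exponential `exp(S) = ∑_{k≥0} S^k / k!` of a power series `S` with zero
constant term: the coefficient of `z^d` only involves `S^k` for `k ≤ d`. -/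
noncomputable def expPS (S : PowerSeries ℚ) : PowerSeries ℚ :=
  PowerSeries.mk fun d => ∑ k ∈ Finset.range (d + 1),
    (PowerSeries.coeff d (S ^ k)) / (Nat.factorial k)


lemma hasSubst_of {S : PowerSeries ℚ} (h : PowerSeries.constantCoeff S = 0) :
    PowerSeries.HasSubst S := PowerSeries.HasSubst.of_constantCoeff_zero' h

lemma coeff_pow_of_lt {S : PowerSeries ℚ} (h : PowerSeries.constantCoeff S = 0) {d k : ℕ}
    (hdk : d < k) : PowerSeries.coeff d (S ^ k) = 0 := by
  have h1 : (PowerSeries.X : PowerSeries ℚ) ∣ S := PowerSeries.X_dvd_iff.mpr h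
  exact PowerSeries.X_pow_dvd_iff.mp (pow_dvd_pow_of_dvd h1 k) d hdk

lemma expPS_eq {S : PowerSeries ℚ} (h : PowerSeries.constantCoeff S = 0) :
    expPS S = (PowerSeries.exp ℚ).subst S := by
  ext d
  rw [PowerSeries.coeff_subst' (hasSubst_of h), expPS, PowerSeries.coeff_mk,
    finsum_eq_sum_of_support_subset (s := Finset.range (d + 1))]
  · refine Finset.sum_congr rfl fun k _ => ?_
    simp [PowerSeries.coeff_exp, div_eq_inv_mul]
  · intro k hk
    simp only [Function.mem_support] at hk
    by_contra hc
    apply hk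
    rw [coeff_pow_of_lt h, smul_zero]
    simpa using hc

lemma deriv_expPS {S : PowerSeries ℚ} (h : PowerSeries.constantCoeff S = 0) :
    PowerSeries.derivative ℚ (expPS S) = PowerSeries.derivative ℚ S * expPS S := by
  rw [expPS_eq h, PowerSeries.derivative_subst (hasSubst_of h), PowerSeries.derivative_exp, mul_comm]

lemma const_expPS (S : PowerSeries ℚ) : PowerSeries.constantCoeff (expPS S) = 1 := by
  rw [← PowerSeries.coeff_zero_eq_constantCoeff_apply, expPS, PowerSeries.coeff_mk]
  simp

lemma ode_unique {A B S : PowerSeries ℚ}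
    (hA : PowerSeries.derivative ℚ A = S * A) (hB : PowerSeries.derivative ℚ B = S * B)
    (cA : PowerSeries.constantCoeff A = 1) (cB : PowerSeries.constantCoeff B = 1) : A = B := by
  have hBi : B * B⁻¹ = 1 := PowerSeries.mul_inv_cancel _ (by rw [cB]; exact one_ne_zero)
  have h : A * B⁻¹ = 1 := by
    apply PowerSeries.derivative.ext
    · rw [Derivation.leibniz, PowerSeries.derivative_inv', hA, hB, PowerSeries.derivative_one]
      simp only [smul_eq_mul]
      linear_combination (-A * S * B⁻¹) * hBi
    · simp [cA, cB]
  calc A = A * (B * B⁻¹) := by rw [hBi, mul_one]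
    _ = (A * B⁻¹) * B := by ring
    _ = B := by rw [h, one_mul]

lemma alt_sum (m : ℕ) : ∑ j ∈ Finset.range (m + 2),
    ((m + 2).choose (j + 1) : ℚ) * (j + 1) ^ j * (-((j : ℚ) + 1)) ^ (m + 1 - j) = 0 := by
  have h := fwdDiff_iter_eq_sum_shift (1 : ℚ) (fun x : ℚ => x ^ (m + 1)) (m + 2) 0
  rw [fwdDiff_iter_pow_eq_zero_of_lt (by omega)] at h
  rw [Finset.sum_range_succ'] at h
  simp at h
  rw [h]
  refine Finset.sum_congr rfl fun j hj => ?_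
  have hj' : j ≤ m + 1 := by simpa [Nat.lt_succ_iff] using hj
  obtain ⟨k, hk⟩ := Nat.exists_eq_add_of_le hj'
  rw [hk, show j + k - j = k by omega, neg_pow ((j : ℚ) + 1)]
  ring

lemma abel_poly (m : ℕ) : ∑ j ∈ Finset.range (m + 1),
    Polynomial.C (((m + 1).choose (j + 1) : ℚ) * (j + 1) ^ j) *
      (Polynomial.X - Polynomial.C ((j : ℚ) + 1)) ^ (m - j) =
    Polynomial.C ((m : ℚ) + 1) * Polynomial.X ^ m := by
  induction m with
  | zero => simp
  | succ m ih =>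
    have hd : Polynomial.derivative (∑ j ∈ Finset.range (m + 2),
      Polynomial.C (((m + 2).choose (j + 1) : ℚ) * (j + 1) ^ j) *
      (Polynomial.X - Polynomial.C ((j : ℚ) + 1)) ^ (m + 1 - j)) = 
      Polynomial.derivative (Polynomial.C ((m : ℚ) + 2) * Polynomial.X ^ (m + 1)) := by
      rw [Finset.sum_range_succ, Polynomial.derivative_add, Polynomial.derivative_sum]
      have : ∀ j ∈ Finset.range (m + 1), Polynomial.derivative (
        Polynomial.C (((m + 2).choose (j + 1) : ℚ) * (j + 1) ^ j) *
        (Polynomial.X - Polynomial.C ((j : ℚ) + 1)) ^ (m + 1 - j)) = Polynomial.C ((m : ℚ) + 2) *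
         (Polynomial.C (((m + 1).choose (j + 1) : ℚ) * (j + 1) ^ j) *
          (Polynomial.X - Polynomial.C ((j : ℚ) + 1)) ^ (m - j)) := by
        intro j hj
        have hj' : j ≤ m := by simpa [Nat.lt_succ_iff] using hj
        obtain ⟨k, rfl⟩ := Nat.exists_eq_add_of_le hj'
        rw [show j + k + 1 - j = k + 1 by omega, show j + k - j = k by omega,
          Polynomial.derivative_C_mul, Polynomial.derivative_X_sub_C_pow]
        have hc := Nat.choose_mul_succ_eq (j + k + 1) (j + 1)
        rw [show j + k + 1 + 1 - (j + 1) = k + 1 by omega] at hc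
        have hc' : ((j + k + 1).choose (j + 1) : ℚ) * (j + k + 2) =
          ((j + k + 2).choose (j + 1) : ℚ) * (k + 1) := by
          have := congrArg (Nat.cast : ℕ → ℚ) hc
          push_cast at this
          rw [← this]; ring
        simp only [Nat.add_sub_cancel]
        rw [← mul_assoc, ← mul_assoc, ← Polynomial.C_mul, ← Polynomial.C_mul]
        congr 2
        push_cast
        linear_combination (-((j : ℚ) + 1) ^ j) * hc'
      rw [Finset.sum_congr rfl this, ← Finset.mul_sum, ih]
      rw [Nat.sub_self, pow_zero, Polynomial.derivative_C_mul, Polynomial.derivative_C_mul,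
        Polynomial.derivative_X_pow]
      simp
    have h0 := Polynomial.eq_C_of_derivative_eq_zero
      ((Polynomial.derivative_sub).trans (sub_eq_zero.mpr hd))
    rw [Polynomial.coeff_zero_eq_eval_zero, Polynomial.eval_sub, Polynomial.eval_finsetSum] at h0
    simp only [Polynomial.eval_mul, Polynomial.eval_C, Polynomial.eval_pow, Polynomial.eval_sub,
      Polynomial.eval_X, zero_sub] at h0
    rw [alt_sum] at h0
    have := sub_eq_zero.mp (h0.trans (by simp))
    rw [show m + 1 + 1 = m + 2 from rfl, this]
    congr 2
    push_cast; ring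

lemma abel_num (m : ℕ) : ∑ j ∈ Finset.range (m + 1),
    (((m + 1).choose (j + 1) : ℚ) * (j + 1) ^ j) * ((m : ℚ) - j) ^ (m - j) =
    ((m : ℚ) + 1) ^ (m + 1) := by
  have h := congrArg (Polynomial.eval ((m : ℚ) + 1)) (abel_poly m)
  rw [Polynomial.eval_finsetSum] at h
  simp only [Polynomial.eval_mul, Polynomial.eval_C, Polynomial.eval_pow, Polynomial.eval_sub,
      Polynomial.eval_X] at h
  rw [pow_succ', ← h]
  refine Finset.sum_congr rfl fun j _ => ?_
  congr 2
  ring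

noncomputable def treeG : PowerSeries ℚ :=
  PowerSeries.mk fun k => ((k : ℚ) + 1) ^ k / (Nat.factorial (k + 1))

lemma treeT_eq : treeT = PowerSeries.X * treeG := by
  ext k
  cases k with
  | zero => simp [treeT]
  | succ k => simp [treeT, treeG, PowerSeries.coeff_succ_X_mul]

lemma const_treeT : PowerSeries.constantCoeff treeT = 0 := by simp [treeT_eq]

lemma treeT0_eq : treeT0 = PowerSeries.X * PowerSeries.derivative ℚ treeT := by
  ext k
  cases k with
  | zero => simp [treeT0]
  | succ k =>
    simp [treeT, treeT0, PowerSeries.coeff_succ_X_mul, PowerSeries.coeff_derivative]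
    ring

lemma T0_mul : (1 + treeT0) * (1 - treeT) = 1 := by
  suffices h : treeT0 = PowerSeries.X * (treeG * (1 + treeT0)) by
    rw [← mul_assoc, ← treeT_eq] at h
    linear_combination h
  ext n
  cases n with
  | zero => simp [treeT0]
  | succ m =>
    rw [PowerSeries.coeff_succ_X_mul, PowerSeries.coeff_mul,
      Finset.Nat.sum_antidiagonal_eq_sum_range_succ_mk]
    have hc : ∀ k : ℕ, PowerSeries.coeff k (1 + treeT0) = (k : ℚ) ^ k / (Nat.factorial k) := by
      intro k
      cases k <;> simp [treeT0, PowerSeries.coeff_one]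
    simp only [hc]
    simp only [treeT0, treeG, PowerSeries.coeff_mk]
    rw [if_neg (Nat.succ_ne_zero m)]
    push_cast
    rw [← abel_num, Finset.sum_div]
    refine Finset.sum_congr rfl fun j hj => ?_
    have hj' : j ≤ m := by simpa [Nat.lt_succ_iff] using hj
    rw [Nat.cast_choose ℚ (show j + 1 ≤ m + 1 by omega), Nat.cast_sub hj',
      show m + 1 - (j + 1) = m - j by omega]
    have h1 : ((m+1).factorial : ℚ) ≠ 0 := by positivity
    have h2 : ((j+1).factorial : ℚ) ≠ 0 := by positivity
    have h3 : ((m-j).factorial : ℚ) ≠ 0 := by positivity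
    field_simp

lemma deriv_T_mul : PowerSeries.derivative ℚ treeT * (1 - treeT) = treeG := by
  apply mul_left_cancel₀ (PowerSeries.X_ne_zero (R := ℚ))
  have h := T0_mul
  have h2 := treeT0_eq
  have h3 := treeT_eq
  linear_combination h - (1 - treeT) * h2 + h3

lemma one_sub_ne : PowerSeries.constantCoeff (1 - treeT) ≠ 0 := by
  simp [const_treeT]

lemma treeInv_mul : (1 - treeT) * (1 - treeT)⁻¹ = 1 := PowerSeries.mul_inv_cancel _ one_sub_ne

lemma deriv_G : PowerSeries.derivative ℚ treeG = PowerSeries.derivative ℚ treeT * treeG := by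
  have hT : PowerSeries.derivative ℚ treeT =
      treeG + PowerSeries.X * PowerSeries.derivative ℚ treeG := by
    conv_lhs => rw [treeT_eq]
    rw [Derivation.leibniz, PowerSeries.derivative_X]
    simp only [smul_eq_mul]; ring
  have h1 := deriv_T_mul
  have hne : (1 - treeT) ≠ 0 := fun h => one_sub_ne (by rw [h, map_zero])
  apply mul_right_cancel₀ hne
  apply mul_left_cancel₀ (PowerSeries.X_ne_zero (R := ℚ))
  have h3 := treeT_eq
  linear_combination (1 - PowerSeries.X * treeG) * h1 - (1 - treeT) * hT + treeG * h3

lemma const_G : PowerSeries.constantCoeff treeG = 1 := by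
  rw [← PowerSeries.coeff_zero_eq_constantCoeff_apply, treeG, PowerSeries.coeff_mk]
  simp

lemma exp_n (n : ℕ) : expPS (n • treeT) = treeG ^ n := by
  have h0 : PowerSeries.constantCoeff (n • treeT) = 0 := by simp [const_treeT]
  apply ode_unique (deriv_expPS h0) _ (const_expPS _) (by simp [const_G])
  rw [PowerSeries.derivative_pow, deriv_G, map_nsmul]
  cases n with
  | zero => simp
  | succ n => simp only [Nat.add_sub_cancel, nsmul_eq_mul]; ring

lemma deriv_T : PowerSeries.derivative ℚ treeT = treeG * (1 - treeT)⁻¹ := by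
  linear_combination (1 - treeT)⁻¹ * deriv_T_mul - PowerSeries.derivative ℚ treeT * treeInv_mul

lemma deriv_treeInv : PowerSeries.derivative ℚ (1 - treeT)⁻¹ = treeG * (1 - treeT)⁻¹ ^ 3 := by
  rw [PowerSeries.derivative_inv', map_sub, PowerSeries.derivative_one, deriv_T]
  ring

lemma T0_inv : treeT0 = (1 - treeT)⁻¹ - 1 := by
  linear_combination (1 - treeT)⁻¹ * T0_mul - (1 + treeT0) * treeInv_mul

lemma T_inv : treeT * (1 - treeT)⁻¹ = (1 - treeT)⁻¹ - 1 := by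
  linear_combination - treeInv_mul

theorem stmt_0 (F : ℕ → Polynomial ℚ) (hF1 : F 1 = 1)
    (hFrec : ∀ n : ℕ, 1 ≤ n → F (n + 1) =
      (Polynomial.C (2 * (n : ℚ) + 2) + Polynomial.C ((n : ℚ) + 2) * Polynomial.X) * F n
        + (1 + Polynomial.X) ^ 2 * Polynomial.derivative (F n)) :
    ∀ n : ℕ, 1 ≤ n →
      (PowerSeries.derivativeFun (R := ℚ))^[n] treeT0 =
        expPS (n • treeT) * ((1 - treeT)⁻¹) ^ (n + 2) *
          Polynomial.aeval (treeT * (1 - treeT)⁻¹) (F n) := by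
  have hdf : ∀ f : PowerSeries ℚ, PowerSeries.derivativeFun f = PowerSeries.derivative ℚ f :=
    fun f => rfl
  intro n hn
  rw [exp_n, T_inv]
  induction n, hn using Nat.le_induction with
  | base =>
    rw [Function.iterate_one, hdf, T0_inv, map_sub, PowerSeries.derivative_one, deriv_treeInv, hF1]
    simp
  | succ n hn ih =>
    rw [Function.iterate_succ_apply', ih, hdf, hFrec n hn]
    have hch : PowerSeries.derivative ℚ (Polynomial.aeval ((1 - treeT)⁻¹ - 1) (F n)) =
        Polynomial.aeval ((1 - treeT)⁻¹ - 1) (Polynomial.derivative (F n)) *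
          (treeG * (1 - treeT)⁻¹ ^ 3) := by
      rw [Derivation.comp_aeval_eq, map_sub, PowerSeries.derivative_one, deriv_treeInv]
      simp
    have hG : PowerSeries.derivative ℚ (treeG ^ n) =
        (n : PowerSeries ℚ) * treeG ^ (n + 1) * (1 - treeT)⁻¹ := by
      rw [PowerSeries.derivative_pow, deriv_G, deriv_T]
      cases n with
      | zero => simp
      | succ n => simp only [Nat.add_sub_cancel]; ring
    rw [Derivation.leibniz, Derivation.leibniz, hch, hG, PowerSeries.derivative_pow, deriv_treeInv]
    have hC : ∀ q : ℚ, algebraMap ℚ (PowerSeries ℚ) q = PowerSeries.C q := fun q => rfl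
    simp only [smul_eq_mul, map_add, map_mul, map_pow, map_one, Polynomial.aeval_X,
      Polynomial.aeval_C, map_natCast, map_ofNat, Nat.add_sub_cancel,
      show n + 2 - 1 = n + 1 by omega]
    push_cast
    ring
end

section
/- In the ring of formal power series ℚ⟦z⟧, let T = ∑_{k≥1} k^{k-1} z^k/k!, let f = T·(1−T)^{-1} (well defined since 1−T has constant term 1), and let g = z·(1+z)^{-1}·exp(−z·(1+z)^{-1}), where exp(S) = ∑_{k≥0} S^k/k! for a power series S with zero constant term. Then f and g are compositional inverses of each other: substituting g into f gives z, and substituting f into g gives z. -/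
open PowerSeries

/-- Formal composition `f(g(z))` of power series, valid when `g` has zero constant
term: the coefficient of `z^d` only involves `g^k` for `k ≤ d`. -/
noncomputable def compPS (f g : PowerSeries ℚ) : PowerSeries ℚ :=
  PowerSeries.mk fun d => ∑ k ∈ Finset.range (d + 1),
    (PowerSeries.coeff k f) * (PowerSeries.coeff d (g ^ k))


theorem compPS_eq_subst (f g : PowerSeries ℚ) (hg : constantCoeff g = 0) :
    compPS f g = f.subst g := by
  ext d
  rw [coeff_subst' (HasSubst.of_constantCoeff_zero' hg), compPS, coeff_mk,
    finsum_eq_sum_of_support_subset]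
  · rfl
  · intro k hk
    by_contra h
    apply hk
    simp only [Finset.coe_range, Set.mem_Iio, not_lt] at h
    obtain ⟨B, rfl⟩ : X ∣ g := by rwa [X_dvd_iff]
    have : ¬ k ≤ d := by omega
    simp [mul_pow, coeff_X_pow_mul', this]

theorem expPS_eq_subst (g : PowerSeries ℚ) (hg : constantCoeff g = 0) :
    expPS g = (exp ℚ).subst g := by
  rw [← compPS_eq_subst _ _ hg]
  ext d
  simp only [expPS, compPS, coeff_mk, coeff_exp]
  refine Finset.sum_congr rfl fun k _ => ?_
  simp [div_eq_inv_mul]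

theorem altsum (d : ℕ) (hd : 2 ≤ d) :
    ∑ k ∈ Finset.range (d + 1), (-1 : ℚ) ^ (d - k) * d.choose k * (k : ℚ) ^ (d - 1) = 0 := by
  have h1 := fwdDiff_iter_eq_sum_shift (1 : ℚ) (fun x : ℚ => x ^ (d - 1)) d 0
  have h2 := fwdDiff_iter_pow_eq_zero_of_lt (R := ℚ) (n := d) (j := d - 1) (by omega)
  rw [h2] at h1
  simpa using h1.symm

theorem tree_subst :
    treeT.subst (X * rescale (-1 : ℚ) (exp ℚ)) = (X : PowerSeries ℚ) := by
  rw [← compPS_eq_subst _ _ (by simp)]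
  ext d
  have key : ∀ k ∈ Finset.range (d + 1), coeff k treeT *
      coeff d ((X * rescale (-1 : ℚ) (exp ℚ)) ^ k) =
      if k = 0 then 0 else
      ((-1 : ℚ) ^ (d - k) * d.choose k * (k : ℚ) ^ (d - 1)) / d.factorial := by
    intro k hk
    have hk' : k ≤ d := by simpa [Nat.lt_succ_iff] using hk
    rw [mul_pow, coeff_X_pow_mul', if_pos hk', ← map_pow, exp_pow_eq_rescale_exp,
      coeff_rescale, coeff_rescale, coeff_exp, treeT, coeff_mk]
    split_ifs with h0
    · simp
    · rw [Nat.cast_choose ℚ hk', show d - 1 = (k - 1) + (d - k) by omega, pow_add]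
      have := Nat.factorial_ne_zero d
      have := Nat.factorial_ne_zero k
      have := Nat.factorial_ne_zero (d - k)
      simp
      field_simp
  rw [compPS, coeff_mk, Finset.sum_congr rfl key, coeff_X]
  rcases Nat.lt_or_ge d 2 with h | h
  · interval_cases d <;> simp [Finset.sum_range_succ]
  · have hz := congrArg (fun x : ℚ => x / d.factorial) (altsum d h)
    simp only [zero_div, Finset.sum_div] at hz
    rw [if_neg (by omega)]
    refine Eq.trans ?_ hz
    refine Finset.sum_congr rfl fun k _ => ?_
    split_ifs with h0
    · subst h0
      simp [show d - 1 ≠ 0 by omega]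
    · rfl

theorem stmt_6 :
    compPS (treeT * (1 - treeT)⁻¹)
        (PowerSeries.X * (1 + PowerSeries.X)⁻¹ *
          expPS (-(PowerSeries.X * (1 + PowerSeries.X)⁻¹))) = PowerSeries.X ∧
    compPS (PowerSeries.X * (1 + PowerSeries.X)⁻¹ *
          expPS (-(PowerSeries.X * (1 + PowerSeries.X)⁻¹)))
        (treeT * (1 - treeT)⁻¹) = PowerSeries.X := by
  have hT0 : constantCoeff treeT = 0 := by simp [treeT, ← coeff_zero_eq_constantCoeff_apply]
  have hunit : (1 + X : PowerSeries ℚ) * (1 + X)⁻¹ = 1 := PowerSeries.mul_inv_cancel _ (by simp)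
  have hTu : (1 - treeT) * (1 - treeT)⁻¹ = 1 := PowerSeries.mul_inv_cancel _ (by simp [hT0])
  set a : PowerSeries ℚ := X * (1 + X)⁻¹ with ha
  have ha0 : constantCoeff a = 0 := by simp [ha]
  have ha0' : constantCoeff (-a) = 0 := by simp [ha]
  have hsa := HasSubst.of_constantCoeff_zero' ha0
  set f := treeT * (1 - treeT)⁻¹ with hf
  have hf0 : constantCoeff f = 0 := by simp [hf, hT0]
  rw [expPS_eq_subst _ ha0']
  set g := a * (exp ℚ).subst (-a) with hg
  have hg0 : constantCoeff g = 0 := by simp [hg, ha0]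
  have hsg := HasSubst.of_constantCoeff_zero' hg0
  rw [compPS_eq_subst _ _ hg0, compPS_eq_subst _ _ hf0]
  have hga : (X * rescale (-1 : ℚ) (exp ℚ)).subst a = g := by
    rw [subst_mul hsa, subst_X hsa, rescale_eq_subst,
      subst_comp_subst_apply (HasSubst.smul_X' _) hsa, subst_smul hsa, subst_X hsa, hg]
    simp
  have hTg : treeT.subst g = a := by
    rw [← hga, ← subst_comp_subst_apply (HasSubst.of_constantCoeff_zero' (by simp)) hsa,
      tree_subst, subst_X hsa]
  have h1 : (1 - a) * (1 + X) = 1 := by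
    linear_combination (-X : PowerSeries ℚ) * hunit
  have hfg : f.subst g = X := by
    have e := congrArg (subst g) hTu
    have one : (1 : PowerSeries ℚ).subst g = 1 := by
      rw [← coe_substAlgHom hsg, map_one]
    rw [subst_mul hsg, subst_sub hsg, one, hTg] at e
    rw [hf, subst_mul hsg, hTg]
    have e2 : (1 - treeT)⁻¹.subst g = 1 + X := by
      linear_combination (1 + X) * e - (1 - treeT)⁻¹.subst g * h1
    rw [e2, ha]
    linear_combination (X : PowerSeries ℚ) * hunit
  refine ⟨hfg, ?_⟩
  have hg1 : IsUnit (coeff 1 g) := by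
    have : constantCoeff ((exp ℚ).subst (-a)) = 1 := by
      rw [← expPS_eq_subst _ ha0', expPS, ← coeff_zero_eq_constantCoeff_apply]
      simp
    have : coeff 1 g = 1 := by
      rw [hg, ha, mul_assoc, ← zero_add 1, coeff_succ_X_mul]
      rw [ha] at this
      simp [this]
    rw [this]; exact isUnit_one
  have hR := subst_substInvOfIsUnit_right g hg0 hg1
  have hs := HasSubst.substInvOfIsUnit g hg1
  have : f = g.substInvOfIsUnit hg1 := by
    have e := subst_comp_subst_apply hsg hs f
    rw [hfg, hR, subst_X hs, X_subst] at e
    exact e.symm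
  rw [this, hR]
end

section
/- Let (G_n)_{n≥1} and (H_n)_{n≥1} be the sequences of polynomials in ℚ[x] defined by G₁(x) = H₁(x) = 1, G_{n+1}(x) = (2n+nx)·G_n(x) + (1+x)²·G_n′(x), and H_{n+1}(x) = (2n−1+(n−1)x)·H_n(x) + (1+x)²·H_n′(x). Then for every n ≥ 1, H_n(x) = G_n(x) − ((1+x)/2) · ∑_{k=1}^{n−1} binom(n,k) · G_k(x) · G_{n−k}(x). Equivalently, the exponential generating functions G̃(x,u) = ∑_{n≥1}(uⁿ/n!)G_n(x) and H̃(x,u) = ∑_{n≥1}(uⁿ/n!)H_n(x), viewed as formal power series in u with polynomial coefficients, satisfy H̃ = G̃ − ((1+x)/2)·G̃². -/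
open Polynomial


/-- Coefficientwise derivative of a power series with polynomial coefficients. -/
noncomputable def dx (f : PowerSeries (Polynomial ℚ)) : PowerSeries (Polynomial ℚ) :=
  PowerSeries.mk fun n => Polynomial.derivative (PowerSeries.coeff n f)

lemma dx_mul (f g : PowerSeries (Polynomial ℚ)) : dx (f * g) = dx f * g + f * dx g := by
  ext1 n
  simp only [dx, PowerSeries.coeff_mk, PowerSeries.coeff_mul, map_add, Polynomial.derivative_sum,
    Polynomial.derivative_mul, Finset.sum_add_distrib]

lemma dx_sub (f g : PowerSeries (Polynomial ℚ)) : dx (f - g) = dx f - dx g := by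
  ext1 n
  simp [dx]

lemma dx_C (c : Polynomial ℚ) :
    dx (PowerSeries.C c) = PowerSeries.C (Polynomial.derivative c) := by
  ext1 n
  simp only [dx, PowerSeries.coeff_mk, PowerSeries.coeff_C]
  split_ifs <;> simp

/-- The exponential generating function without constant term. -/
noncomputable def egf (G : ℕ → Polynomial ℚ) : PowerSeries (Polynomial ℚ) :=
  PowerSeries.mk (fun n => if n = 0 then 0 else Polynomial.C ((Nat.factorial n : ℚ)⁻¹) * G n)

lemma egf_rec (G : ℕ → Polynomial ℚ) (c : ℚ) (h1 : G 1 = 1)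
    (hrec : ∀ n : ℕ, 1 ≤ n → G (n + 1) =
      (Polynomial.C (2 * (n : ℚ) - c) + Polynomial.C ((n : ℚ) - c) * Polynomial.X) * G n
        + (1 + Polynomial.X) ^ 2 * Polynomial.derivative (G n)) :
    PowerSeries.derivative (Polynomial ℚ) (egf G) =
      1 + PowerSeries.C (2 + Polynomial.X) *
        (PowerSeries.X * PowerSeries.derivative (Polynomial ℚ) (egf G))
      + PowerSeries.C ((1 + Polynomial.X) ^ 2) * dx (egf G)
      - PowerSeries.C (Polynomial.C c * (1 + Polynomial.X)) * egf G := by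
  ext1 n
  rcases n with _ | n
  · simp [PowerSeries.coeff_derivative, dx, egf, h1]
  · have hn := hrec (n + 1) (by omega)
    have h2 : (Polynomial.C (((n + 1 + 1).factorial : ℚ)⁻¹)) * ((n : Polynomial ℚ) + 1 + 1)
        = Polynomial.C (((n + 1).factorial : ℚ)⁻¹) := by
      have : ((n : Polynomial ℚ) + 1 + 1) = Polynomial.C ((n : ℚ) + 1 + 1) := by simp
      rw [this, ← Polynomial.C_mul, Nat.factorial_succ (n + 1)]
      congr 1
      push_cast
      have : ((n + 1).factorial : ℚ) ≠ 0 := by positivity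
      have : (n : ℚ) + 1 + 1 ≠ 0 := by positivity
      field_simp
    rw [map_sub, map_add, map_add]
    simp only [PowerSeries.coeff_C_mul, PowerSeries.coeff_succ_X_mul,
      PowerSeries.coeff_derivative, dx, egf, PowerSeries.coeff_mk, PowerSeries.coeff_one]
    simp only [Nat.add_eq_zero_iff, one_ne_zero, and_false, if_false, hn,
      Polynomial.derivative_C_mul]
    push_cast
    rw [mul_right_comm, h2]
    simp only [map_sub, map_add, map_mul, map_natCast, map_one, map_ofNat]
    ring

lemma uniq (A B : PowerSeries (Polynomial ℚ)) (p q r : Polynomial ℚ)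
    (h0 : PowerSeries.coeff 0 A = PowerSeries.coeff 0 B)
    (hA : PowerSeries.derivative (Polynomial ℚ) A = 1 + PowerSeries.C p *
        (PowerSeries.X * PowerSeries.derivative (Polynomial ℚ) A)
      + PowerSeries.C q * dx A - PowerSeries.C r * A)
    (hB : PowerSeries.derivative (Polynomial ℚ) B = 1 + PowerSeries.C p *
        (PowerSeries.X * PowerSeries.derivative (Polynomial ℚ) B)
      + PowerSeries.C q * dx B - PowerSeries.C r * B) : A = B := by
  ext1 n
  induction n with
  | zero => exact h0
  | succ n ih =>
    have a := congrArg (PowerSeries.coeff n) hA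
    have b := congrArg (PowerSeries.coeff n) hB
    have e : PowerSeries.coeff n (PowerSeries.X * PowerSeries.derivative (Polynomial ℚ) A)
        = PowerSeries.coeff n (PowerSeries.X * PowerSeries.derivative (Polynomial ℚ) B) := by
      rcases n with _ | n
      · simp
      · simp only [PowerSeries.coeff_succ_X_mul, PowerSeries.coeff_derivative, ih]
    simp only [map_sub, map_add, PowerSeries.coeff_C_mul, e] at a b
    rw [PowerSeries.coeff_derivative] at a b
    simp only [dx, PowerSeries.coeff_mk, ih] at a b
    have : ((n : Polynomial ℚ) + 1) ≠ 0 := by exact_mod_cast Nat.succ_ne_zero n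
    exact mul_right_cancel₀ this (a.trans b.symm)

theorem stmt_10 (G H : ℕ → Polynomial ℚ) (hG1 : G 1 = 1) (hH1 : H 1 = 1)
    (hGrec : ∀ n : ℕ, 1 ≤ n → G (n + 1) =
      (Polynomial.C (2 * (n : ℚ)) + Polynomial.C (n : ℚ) * Polynomial.X) * G n
        + (1 + Polynomial.X) ^ 2 * Polynomial.derivative (G n))
    (hHrec : ∀ n : ℕ, 1 ≤ n → H (n + 1) =
      (Polynomial.C (2 * (n : ℚ) - 1) + Polynomial.C ((n : ℚ) - 1) * Polynomial.X) * H n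
        + (1 + Polynomial.X) ^ 2 * Polynomial.derivative (H n)) :
    (∀ n : ℕ, 1 ≤ n →
      H n = G n - Polynomial.C (1 / 2 : ℚ) * (1 + Polynomial.X) *
        ∑ k ∈ Finset.Ioo 0 n, Polynomial.C (n.choose k : ℚ) * G k * G (n - k)) ∧
    (PowerSeries.mk (fun n => if n = 0 then 0 else
        Polynomial.C ((Nat.factorial n : ℚ)⁻¹) * H n) =
      PowerSeries.mk (fun n => if n = 0 then 0 else
        Polynomial.C ((Nat.factorial n : ℚ)⁻¹) * G n) -
      PowerSeries.C (R := Polynomial ℚ) (Polynomial.C (1 / 2 : ℚ) * (1 + Polynomial.X)) *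
        (PowerSeries.mk (fun n => if n = 0 then 0 else
          Polynomial.C ((Nat.factorial n : ℚ)⁻¹) * G n)) ^ 2) := by
  have key : egf H = egf G -
      PowerSeries.C (Polynomial.C (1 / 2 : ℚ) * (1 + Polynomial.X)) * (egf G) ^ 2 := by
    have hG := egf_rec G 0 hG1 (by simpa using hGrec)
    have hH := egf_rec H 1 hH1 hHrec
    refine uniq _ _ _ _ _ ?_ hH ?_
    · simp [egf]
    · set g := egf G
      have hc : PowerSeries.C (Polynomial.C (1 / 2 : ℚ) * (1 + Polynomial.X))
          = PowerSeries.C (Polynomial.C (1 / 2 : ℚ)) * PowerSeries.C (1 + Polynomial.X) := map_mul _ _ _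
      have hh : (PowerSeries.C (Polynomial.C (1 / 2 : ℚ))) * 2 = 1 := by
        have : (2 : PowerSeries (Polynomial ℚ)) = PowerSeries.C (Polynomial.C 2) :=
          (map_ofNat (PowerSeries.C.comp (Polynomial.C (R := ℚ))) 2).symm
        rw [this, ← map_mul, ← map_mul]
        norm_num
      have hd : PowerSeries.derivative (Polynomial ℚ) (g - PowerSeries.C (Polynomial.C (1 / 2 : ℚ) * (1 + Polynomial.X)) * g ^ 2)
          = (1 - PowerSeries.C (1 + Polynomial.X) * g) * PowerSeries.derivative (Polynomial ℚ) g := by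
        rw [hc, pow_two]
        simp only [map_sub, Derivation.leibniz, smul_eq_mul, PowerSeries.derivative_C]
        linear_combination (-(PowerSeries.C (1 + Polynomial.X) * g * PowerSeries.derivative (Polynomial ℚ) g)) * hh
      have hx : dx (g - PowerSeries.C (Polynomial.C (1 / 2 : ℚ) * (1 + Polynomial.X)) * g ^ 2)
          = (1 - PowerSeries.C (1 + Polynomial.X) * g) * dx g
            - PowerSeries.C (Polynomial.C (1 / 2 : ℚ)) * g ^ 2 := by
        rw [pow_two, dx_sub, dx_mul, dx_C, dx_mul, hc]
        have : Polynomial.derivative (Polynomial.C (1 / 2 : ℚ) * (1 + Polynomial.X)) = Polynomial.C (1 / 2 : ℚ) := by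
          simp [Polynomial.derivative_mul]
        rw [this]
        linear_combination (-(PowerSeries.C (1 + Polynomial.X) * g * dx g)) * hh
      rw [hd, hx, hc]
      simp only [map_zero, zero_mul, sub_zero] at hG
      simp only [map_one, one_mul, map_pow] at hG ⊢
      linear_combination (1 - PowerSeries.C (1 + Polynomial.X) * g) * hG
        + (0 : PowerSeries (Polynomial ℚ)) * hh
  refine ⟨fun n hn => ?_, key⟩
  have h := congrArg (PowerSeries.coeff n) key
  have hn0 : n ≠ 0 := by omega
  rw [pow_two, map_sub, PowerSeries.coeff_C_mul, PowerSeries.coeff_mul,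
    Finset.Nat.sum_antidiagonal_eq_sum_range_succ_mk] at h
  simp only [egf, PowerSeries.coeff_mk, hn0, if_false] at h
  have hsum : ∑ k ∈ Finset.Ioo 0 n, Polynomial.C (n.choose k : ℚ) * G k * G (n - k)
      = Polynomial.C (n.factorial : ℚ) * ∑ k ∈ Finset.range n.succ,
        (if k = 0 then 0 else Polynomial.C ((Nat.factorial k : ℚ)⁻¹) * G k) *
        (if n - k = 0 then 0 else Polynomial.C ((Nat.factorial (n - k) : ℚ)⁻¹) * G (n - k)) := by
    rw [Finset.mul_sum]
    have hsub : Finset.Ioo 0 n ⊆ Finset.range n.succ := by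
      intro k hk
      simp at hk ⊢
      omega
    rw [← Finset.sum_subset hsub]
    · refine Finset.sum_congr rfl fun k hk => ?_
      rw [Finset.mem_Ioo] at hk
      rw [if_neg (by omega), if_neg (by omega), Nat.cast_choose ℚ hk.2.le, div_eq_mul_inv, mul_inv]
      simp only [map_mul]
      ring
    · intro k hk hk2
      simp only [Finset.mem_Ioo, Finset.mem_range] at hk hk2
      by_cases h0 : k = 0
      · simp [h0]
      · rw [if_pos (show n - k = 0 by omega)]
        simp
  have hf : Polynomial.C (n.factorial : ℚ) * Polynomial.C ((n.factorial : ℚ)⁻¹) = 1 := by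
    rw [← Polynomial.C_mul, mul_inv_cancel₀ (by positivity), Polynomial.C_1]
  rw [hsum]
  linear_combination Polynomial.C (n.factorial : ℚ) * h + (G n - H n) * hf
end

section
/- Let Q_{n,k} ∈ ℚ[x] (for n ≥ 1, 0 ≤ k ≤ n−1) be defined by Q_{1,0}(x) = 1, Q_{n,k} = 0 when k < 0 or k > n−1, and Q_{n,k}(x) = (x+n−1)·Q_{n−1,k}(x) + (n+k−2)·Q_{n−1,k−1}(x) for n ≥ 2. Let (G_n)_{n≥1} be defined by G₁(x) = 1 and G_{n+1}(x) = (2n+nx)·G_n(x) + (1+x)²·G_n′(x). Then for every n ≥ 1, ∑_{k=0}^{n−1} Q_{n,k}(0)·x^k = G_n(x−1), where Q_{n,k}(0) denotes the evaluation of Q_{n,k} at 0. -/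
open Polynomial

theorem stmt_17 (Q : ℕ → ℕ → Polynomial ℚ)
    (hQ10 : Q 1 0 = 1)
    (hQzero : ∀ n k : ℕ, n ≤ k → Q n k = 0)
    (hQrec0 : ∀ n : ℕ, 2 ≤ n →
      Q n 0 = (Polynomial.X + Polynomial.C ((n : ℚ) - 1)) * Q (n - 1) 0)
    (hQrec : ∀ n : ℕ, 2 ≤ n → ∀ k : ℕ, 1 ≤ k →
      Q n k = (Polynomial.X + Polynomial.C ((n : ℚ) - 1)) * Q (n - 1) k
        + Polynomial.C ((n : ℚ) + (k : ℚ) - 2) * Q (n - 1) (k - 1))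
    (G : ℕ → Polynomial ℚ) (hG1 : G 1 = 1)
    (hGrec : ∀ n : ℕ, 1 ≤ n → G (n + 1) =
      (Polynomial.C (2 * (n : ℚ)) + Polynomial.C (n : ℚ) * Polynomial.X) * G n
        + (1 + Polynomial.X) ^ 2 * Polynomial.derivative (G n)) :
    ∀ n : ℕ, 1 ≤ n →
      ∑ k ∈ Finset.range n, Polynomial.C ((Q n k).eval 0) * Polynomial.X ^ k
        = (G n).comp (Polynomial.X - 1) := by
  have key : ∀ n : ℕ, 1 ≤ n → ∀ k : ℕ,
      ((G n).comp (Polynomial.X - 1)).coeff k = (Q n k).eval 0 := by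
    intro n hn
    induction n, hn using Nat.le_induction with
    | base =>
      intro k
      rw [hG1]
      rcases Nat.eq_zero_or_pos k with rfl | hk
      · simp [hQ10]
      · rw [hQzero 1 k hk]
        simp [Polynomial.coeff_one, hk.ne']
    | succ n hn ih =>
      intro k
      have hrec : (G (n + 1)).comp (Polynomial.X - 1) =
          Polynomial.C (n : ℚ) * (G n).comp (Polynomial.X - 1)
          + (Polynomial.C (n : ℚ) * (G n).comp (Polynomial.X - 1)
            + Polynomial.X * Polynomial.derivative ((G n).comp (Polynomial.X - 1)))
            * Polynomial.X := by
        rw [hGrec n hn, Polynomial.derivative_comp]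
        simp only [Polynomial.add_comp, Polynomial.mul_comp, Polynomial.pow_comp,
          Polynomial.C_comp, Polynomial.X_comp, Polynomial.one_comp,
          Polynomial.derivative_sub, Polynomial.derivative_X, Polynomial.derivative_one,
          Polynomial.C_mul]
        have h2 : (Polynomial.C (2 : ℚ)) = 2 := rfl
        rw [h2]
        ring
      rw [hrec]
      rcases k with _ | k
      · rw [hQrec0 (n + 1) (by omega)]
        simp [ih]
      · rw [hQrec (n + 1) (by omega) (k + 1) (by omega)]
        rw [Polynomial.coeff_add, Polynomial.coeff_mul_X, Polynomial.coeff_add,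
          Polynomial.coeff_C_mul, Polynomial.coeff_C_mul, ih, ih]
        have hd : (Polynomial.X *
            Polynomial.derivative ((G n).comp (Polynomial.X - 1))).coeff k
            = (k : ℚ) * (Q n k).eval 0 := by
          rcases k with _ | k
          · simp
          · rw [Polynomial.coeff_X_mul, Polynomial.coeff_derivative, ih]
            push_cast
            ring
        rw [hd]
        simp only [Nat.add_sub_cancel, Polynomial.eval_add, Polynomial.eval_mul,
          Polynomial.eval_X, Polynomial.eval_C]
        push_cast
        ring
  intro n hn
  ext k
  rw [key n hn k, Polynomial.finset_sum_coeff]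
  simp only [Polynomial.coeff_C_mul_X_pow]
  rw [Finset.sum_ite_eq]
  split_ifs with h
  · rfl
  · rw [hQzero n k (by simpa using h)]
    simp
end

section
/- Let Q_{n,k} ∈ ℚ[x] (for n ≥ 1, 0 ≤ k ≤ n−1) be defined by Q_{1,0}(x) = 1, Q_{n,k} = 0 when k < 0 or k > n−1, and Q_{n,k}(x) = (x+n−1)·Q_{n−1,k}(x) + (n+k−2)·Q_{n−1,k−1}(x) for n ≥ 2. Let (F_n)_{n≥1} be defined by F₁(x) = 1 and F_{n+1}(x) = (2n+2+(n+2)x)·F_n(x) + (1+x)²·F_n′(x). Then for every n ≥ 2, ∑_{k=0}^{n−1} Q_{n,k}(−1)·x^k = x·F_{n−1}(x−1), where Q_{n,k}(−1) denotes the evaluation of Q_{n,k} at −1. -/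
open Polynomial

theorem stmt_19 (Q : ℕ → ℕ → Polynomial ℚ)
    (hQ10 : Q 1 0 = 1)
    (hQzero : ∀ n k : ℕ, n ≤ k → Q n k = 0)
    (hQrec0 : ∀ n : ℕ, 2 ≤ n →
      Q n 0 = (Polynomial.X + Polynomial.C ((n : ℚ) - 1)) * Q (n - 1) 0)
    (hQrec : ∀ n : ℕ, 2 ≤ n → ∀ k : ℕ, 1 ≤ k →
      Q n k = (Polynomial.X + Polynomial.C ((n : ℚ) - 1)) * Q (n - 1) k
        + Polynomial.C ((n : ℚ) + (k : ℚ) - 2) * Q (n - 1) (k - 1))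
    (F : ℕ → Polynomial ℚ) (hF1 : F 1 = 1)
    (hFrec : ∀ n : ℕ, 1 ≤ n → F (n + 1) =
      (Polynomial.C (2 * (n : ℚ) + 2) + Polynomial.C ((n : ℚ) + 2) * Polynomial.X) * F n
        + (1 + Polynomial.X) ^ 2 * Polynomial.derivative (F n)) :
    ∀ n : ℕ, 2 ≤ n →
      ∑ k ∈ Finset.range n, Polynomial.C ((Q n k).eval (-1)) * Polynomial.X ^ k
        = Polynomial.X * (F (n - 1)).comp (Polynomial.X - 1) := by
  have hc : ∀ n k : ℕ, (∑ k ∈ Finset.range n, Polynomial.C ((Q n k).eval (-1)) * Polynomial.X ^ k).coeff k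
      = (Q n k).eval (-1) := by
    intro n k
    rw [Polynomial.finsetSum_coeff]
    simp only [Polynomial.coeff_C_mul_X_pow]
    rw [Finset.sum_ite_eq]
    split_ifs with h
    · rfl
    · rw [hQzero n k (by simpa using h)]; simp
  have hP : ∀ n : ℕ, 1 ≤ n →
      ∑ k ∈ Finset.range (n+1), Polynomial.C ((Q (n+1) k).eval (-1)) * Polynomial.X ^ k
      = Polynomial.C ((n : ℚ) - 1) * (∑ k ∈ Finset.range n, Polynomial.C ((Q n k).eval (-1)) * Polynomial.X ^ k)
        + Polynomial.C (n : ℚ) * ((∑ k ∈ Finset.range n, Polynomial.C ((Q n k).eval (-1)) * Polynomial.X ^ k) * Polynomial.X)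
        + Polynomial.derivative (∑ k ∈ Finset.range n, Polynomial.C ((Q n k).eval (-1)) * Polynomial.X ^ k) * Polynomial.X * Polynomial.X := by
    intro n hn
    ext k
    rw [hc]
    simp only [Polynomial.coeff_add, Polynomial.coeff_C_mul, hc]
    rcases k with _ | _ | k
    · rw [hQrec0 (n+1) (by omega)]
      simp
      left; ring
    · rw [hQrec (n+1) (by omega) _ (by omega)]
      simp [Polynomial.coeff_mul_X, hc]
      ring
    · rw [hQrec (n+1) (by omega) _ (by omega)]
      simp only [Polynomial.coeff_mul_X, Polynomial.coeff_derivative, hc]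
      simp
      ring
  intro n hn
  induction n, hn using Nat.le_induction with
  | base =>
    rw [hP 1 le_rfl]
    simp [hQ10, hF1]
  | succ n hn ih =>
    rw [hP n (by omega), ih]
    obtain ⟨m, rfl⟩ : ∃ m, n = m + 2 := ⟨n - 2, by omega⟩
    have e1 : m + 2 - 1 = m + 1 := rfl
    have e2 : m + 2 + 1 - 1 = (m + 1) + 1 := rfl
    rw [e1, e2, hFrec (m+1) (by omega)]
    have h2 : (Polynomial.C 2 : Polynomial ℚ) = 2 := rfl
    simp [Polynomial.derivative_comp, h2]
    ring
end
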